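/- Let W be the set of all maximal J_n.lin-consistent sets of L_{[<n]}-formulas with the canonical relations <_m. Suppose x ∈ W, k < n, and ¬[k]ψ ∈ x. Then there is y ∈ W such that x <_k y and ¬ψ ∧ ⋀_{k≤m<n}[m]ψ ∈ y; in particular, y is k-maximal as witnessed by ψ. -/

import Mathlib

/-- Formulas of the polymodal language `L_{[<ω]}`: propositional variables,
a constant ⊤, Boolean connectives, and a modality `[m]` for each `m : ℕ`. -/
inductive Formula : Type
  | var : ℕ → Formula
  | top : Formula
  | neg : Formula → Formula
  | and : Formula → Formula → Formula
  | or : Formula → Formula → Formula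
  | imp : Formula → Formula → Formula
  | box : ℕ → Formula → Formula
  deriving DecidableEq

namespace Formula

/-- `⊥` abbreviates `¬⊤`. -/
def bot : Formula := neg top

/-- `⟨m⟩φ` abbreviates `¬[m]¬φ`. -/
def dia (m : ℕ) (φ : Formula) : Formula := neg (box m (neg φ))

/-- A formula is closed if it contains no propositional variables. -/
def Closed : Formula → Prop
  | var _ => False
  | top => True
  | neg a => Closed a
  | and a b => Closed a ∧ Closed b
  | or a b => Closed a ∧ Closed b
  | imp a b => Closed a ∧ Closed b
  | box _ a => Closed a

/-- Membership in the language `L_{[<n]}`: all modalities `[m]` have `m < n`. -/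
def InLang (n : ℕ) : Formula → Prop
  | var _ => True
  | top => True
  | neg a => InLang n a
  | and a b => InLang n a ∧ InLang n b
  | or a b => InLang n a ∧ InLang n b
  | imp a b => InLang n a ∧ InLang n b
  | box m a => m < n ∧ InLang n a

/-- Uniform substitution of formulas for propositional variables. -/
def subst (σ : ℕ → Formula) : Formula → Formula
  | var i => σ i
  | top => top
  | neg a => neg (subst σ a)
  | and a b => and (subst σ a) (subst σ b)
  | or a b => or (subst σ a) (subst σ b)
  | imp a b => imp (subst σ a) (subst σ b)
  | box m a => box m (subst σ a)

/-- The number of occurrences of modal operators in a formula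
(diamonds `⟨m⟩` are abbreviations `¬[m]¬`, so each is one box occurrence). -/
def modalCount : Formula → ℕ
  | var _ => 0
  | top => 0
  | neg a => modalCount a
  | and a b => modalCount a + modalCount b
  | or a b => modalCount a + modalCount b
  | imp a b => modalCount a + modalCount b
  | box _ a => modalCount a + 1

end Formula

/-- Conjunction of a finite list of formulas. -/
def bigConj (l : List Formula) : Formula := l.foldr Formula.and Formula.top

/-- `⋀_{m ≤ k < n} [k]φ`. -/
def boxConj (m n : ℕ) (φ : Formula) : Formula :=
  bigConj ((List.range' m (n - m)).map fun k => Formula.box k φ)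

/-- The pseudo-linearity axiom
`[m]((⋀_{m≤k<n}[k]φ) → ψ) ∨ [m]((⋀_{m≤k<n}[k]ψ ∧ ψ) → φ)`. -/
def psLin (n m : ℕ) (φ ψ : Formula) : Formula :=
  Formula.or
    (Formula.box m (Formula.imp (boxConj m n φ) ψ))
    (Formula.box m (Formula.imp (Formula.and (boxConj m n ψ) ψ) φ))

/-- A Boolean valuation of formulas respecting the Boolean connectives
(treating boxed formulas and variables as atoms). -/
def RespectsBool (v : Formula → Bool) : Prop :=
  v Formula.top = true ∧
  (∀ a, v (Formula.neg a) = !(v a)) ∧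
  (∀ a b, v (Formula.and a b) = (v a && v b)) ∧
  (∀ a b, v (Formula.or a b) = (v a || v b)) ∧
  (∀ a b, v (Formula.imp a b) = (!(v a) || v b))

/-- Propositional tautologies of the modal language. -/
def Tautology (φ : Formula) : Prop :=
  ∀ v : Formula → Bool, RespectsBool v → v φ = true

/-- Japaridze's polymodal provability logic `GLP`. -/
inductive GLP : Formula → Prop
  | taut {φ : Formula} : Tautology φ → GLP φ
  | distr (m : ℕ) (φ ψ : Formula) :
      GLP (Formula.imp (Formula.box m (Formula.imp φ ψ))
        (Formula.imp (Formula.box m φ) (Formula.box m ψ)))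
  | lob (m : ℕ) (φ : Formula) :
      GLP (Formula.imp (Formula.box m (Formula.imp (Formula.box m φ) φ)) (Formula.box m φ))
  | mono (m : ℕ) (φ : Formula) :
      GLP (Formula.imp (Formula.box m φ) (Formula.box (m + 1) φ))
  | diaMono (m : ℕ) (φ : Formula) :
      GLP (Formula.imp (Formula.dia m φ) (Formula.box (m + 1) (Formula.dia m φ)))
  | mp {φ ψ : Formula} : GLP (Formula.imp φ ψ) → GLP φ → GLP ψ
  | nec (m : ℕ) {φ : Formula} : GLP φ → GLP (Formula.box m φ)

/-- The logic `GLP.3`: `GLP` together with the linearity axioms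
`[m]([m]A → B) ∨ [m]([m]B ∧ B → A)`. -/
inductive GLP3 : Formula → Prop
  | taut {φ : Formula} : Tautology φ → GLP3 φ
  | distr (m : ℕ) (φ ψ : Formula) :
      GLP3 (Formula.imp (Formula.box m (Formula.imp φ ψ))
        (Formula.imp (Formula.box m φ) (Formula.box m ψ)))
  | lob (m : ℕ) (φ : Formula) :
      GLP3 (Formula.imp (Formula.box m (Formula.imp (Formula.box m φ) φ)) (Formula.box m φ))
  | mono (m : ℕ) (φ : Formula) :
      GLP3 (Formula.imp (Formula.box m φ) (Formula.box (m + 1) φ))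
  | diaMono (m : ℕ) (φ : Formula) :
      GLP3 (Formula.imp (Formula.dia m φ) (Formula.box (m + 1) (Formula.dia m φ)))
  | lin (m : ℕ) (A B : Formula) :
      GLP3 (Formula.or (Formula.box m (Formula.imp (Formula.box m A) B))
        (Formula.box m (Formula.imp (Formula.and (Formula.box m B) B) A)))
  | mp {φ ψ : Formula} : GLP3 (Formula.imp φ ψ) → GLP3 φ → GLP3 ψ
  | nec (m : ℕ) {φ : Formula} : GLP3 φ → GLP3 (Formula.box m φ)

/-- The logic `GLP_n`, i.e. `GLP` restricted to the language `L_{[<n]}`. -/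
inductive GLPn (n : ℕ) : Formula → Prop
  | taut {φ : Formula} : Tautology φ → Formula.InLang n φ → GLPn n φ
  | distr {m : ℕ} (hm : m < n) (φ ψ : Formula)
      (hφ : Formula.InLang n φ) (hψ : Formula.InLang n ψ) :
      GLPn n (Formula.imp (Formula.box m (Formula.imp φ ψ))
        (Formula.imp (Formula.box m φ) (Formula.box m ψ)))
  | lob {m : ℕ} (hm : m < n) (φ : Formula) (hφ : Formula.InLang n φ) :
      GLPn n (Formula.imp (Formula.box m (Formula.imp (Formula.box m φ) φ)) (Formula.box m φ))
  | mono {m : ℕ} (hm : m + 1 < n) (φ : Formula) (hφ : Formula.InLang n φ) :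
      GLPn n (Formula.imp (Formula.box m φ) (Formula.box (m + 1) φ))
  | diaMono {m : ℕ} (hm : m + 1 < n) (φ : Formula) (hφ : Formula.InLang n φ) :
      GLPn n (Formula.imp (Formula.dia m φ) (Formula.box (m + 1) (Formula.dia m φ)))
  | mp {φ ψ : Formula} : GLPn n (Formula.imp φ ψ) → GLPn n φ → GLPn n ψ
  | nec {m : ℕ} (hm : m < n) {φ : Formula} : GLPn n φ → GLPn n (Formula.box m φ)

/-- The logic `GLP_n.3`: `GLP_n` with the linearity axioms for each `m < n`. -/
inductive GLPn3 (n : ℕ) : Formula → Prop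
  | taut {φ : Formula} : Tautology φ → Formula.InLang n φ → GLPn3 n φ
  | distr {m : ℕ} (hm : m < n) (φ ψ : Formula)
      (hφ : Formula.InLang n φ) (hψ : Formula.InLang n ψ) :
      GLPn3 n (Formula.imp (Formula.box m (Formula.imp φ ψ))
        (Formula.imp (Formula.box m φ) (Formula.box m ψ)))
  | lob {m : ℕ} (hm : m < n) (φ : Formula) (hφ : Formula.InLang n φ) :
      GLPn3 n (Formula.imp (Formula.box m (Formula.imp (Formula.box m φ) φ)) (Formula.box m φ))
  | mono {m : ℕ} (hm : m + 1 < n) (φ : Formula) (hφ : Formula.InLang n φ) :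
      GLPn3 n (Formula.imp (Formula.box m φ) (Formula.box (m + 1) φ))
  | diaMono {m : ℕ} (hm : m + 1 < n) (φ : Formula) (hφ : Formula.InLang n φ) :
      GLPn3 n (Formula.imp (Formula.dia m φ) (Formula.box (m + 1) (Formula.dia m φ)))
  | lin {m : ℕ} (hm : m < n) (A B : Formula)
      (hA : Formula.InLang n A) (hB : Formula.InLang n B) :
      GLPn3 n (Formula.or (Formula.box m (Formula.imp (Formula.box m A) B))
        (Formula.box m (Formula.imp (Formula.and (Formula.box m B) B) A)))
  | mp {φ ψ : Formula} : GLPn3 n (Formula.imp φ ψ) → GLPn3 n φ → GLPn3 n ψ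
  | nec {m : ℕ} (hm : m < n) {φ : Formula} : GLPn3 n φ → GLPn3 n (Formula.box m φ)

/-- Beklemishev's logic `J_n`. -/
inductive Jn (n : ℕ) : Formula → Prop
  | taut {φ : Formula} : Tautology φ → Formula.InLang n φ → Jn n φ
  | distr {k : ℕ} (hk : k < n) (φ ψ : Formula)
      (hφ : Formula.InLang n φ) (hψ : Formula.InLang n ψ) :
      Jn n (Formula.imp (Formula.box k (Formula.imp φ ψ))
        (Formula.imp (Formula.box k φ) (Formula.box k ψ)))
  | lob {k : ℕ} (hk : k < n) (φ : Formula) (hφ : Formula.InLang n φ) :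
      Jn n (Formula.imp (Formula.box k (Formula.imp (Formula.box k φ) φ)) (Formula.box k φ))
  | trans1 {k m : ℕ} (hkm : k ≤ m) (hm : m < n) (φ : Formula) (hφ : Formula.InLang n φ) :
      Jn n (Formula.imp (Formula.box k φ) (Formula.box k (Formula.box m φ)))
  | trans2 {k m : ℕ} (hkm : k ≤ m) (hm : m < n) (φ : Formula) (hφ : Formula.InLang n φ) :
      Jn n (Formula.imp (Formula.box k φ) (Formula.box m (Formula.box k φ)))
  | diaMono {k m : ℕ} (hkm : k < m) (hm : m < n) (φ : Formula) (hφ : Formula.InLang n φ) :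
      Jn n (Formula.imp (Formula.dia k φ) (Formula.box m (Formula.dia k φ)))
  | mp {φ ψ : Formula} : Jn n (Formula.imp φ ψ) → Jn n φ → Jn n ψ
  | nec {k : ℕ} (hk : k < n) {φ : Formula} : Jn n φ → Jn n (Formula.box k φ)

/-- The logic `J_n.lin`: `J_n` together with the pseudo-linearity axioms. -/
inductive JnLin (n : ℕ) : Formula → Prop
  | taut {φ : Formula} : Tautology φ → Formula.InLang n φ → JnLin n φ
  | distr {k : ℕ} (hk : k < n) (φ ψ : Formula)
      (hφ : Formula.InLang n φ) (hψ : Formula.InLang n ψ) :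
      JnLin n (Formula.imp (Formula.box k (Formula.imp φ ψ))
        (Formula.imp (Formula.box k φ) (Formula.box k ψ)))
  | lob {k : ℕ} (hk : k < n) (φ : Formula) (hφ : Formula.InLang n φ) :
      JnLin n (Formula.imp (Formula.box k (Formula.imp (Formula.box k φ) φ)) (Formula.box k φ))
  | trans1 {k m : ℕ} (hkm : k ≤ m) (hm : m < n) (φ : Formula) (hφ : Formula.InLang n φ) :
      JnLin n (Formula.imp (Formula.box k φ) (Formula.box k (Formula.box m φ)))
  | trans2 {k m : ℕ} (hkm : k ≤ m) (hm : m < n) (φ : Formula) (hφ : Formula.InLang n φ) :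
      JnLin n (Formula.imp (Formula.box k φ) (Formula.box m (Formula.box k φ)))
  | diaMono {k m : ℕ} (hkm : k < m) (hm : m < n) (φ : Formula) (hφ : Formula.InLang n φ) :
      JnLin n (Formula.imp (Formula.dia k φ) (Formula.box m (Formula.dia k φ)))
  | lin {m : ℕ} (hm : m < n) (φ ψ : Formula)
      (hφ : Formula.InLang n φ) (hψ : Formula.InLang n ψ) :
      JnLin n (psLin n m φ ψ)
  | mp {φ ψ : Formula} : JnLin n (Formula.imp φ ψ) → JnLin n φ → JnLin n ψ
  | nec {k : ℕ} (hk : k < n) {φ : Formula} : JnLin n φ → JnLin n (Formula.box k φ)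

section Frames

variable {T : Type*}

/-- `(T, <_0, …, <_{n-1})` (encoded as `R : ℕ → T → T → Prop`, only the
relations `R i` for `i < n` being relevant) is a `J_n`-frame. -/
def IsJnFrame (n : ℕ) (R : ℕ → T → T → Prop) : Prop :=
  (∀ i < n, Irreflexive (R i)) ∧
  (∀ i < n, Transitive (R i)) ∧
  (∀ i < n, WellFounded fun a b => R i b a) ∧
  ∀ ⦃k m : ℕ⦄, k < m → m < n →
    (∀ ⦃x y z : T⦄, R m x y → R k y z → R k x z) ∧
    (∀ ⦃x y z : T⦄, R k x y → R m y z → R k x z) ∧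
    (∀ ⦃x y z : T⦄, R k x z → R m y z → R k x y)

/-- A frame is hereditarily linear if any two distinct points are comparable
by some relation `<_k`, `k < n`. -/
def HereditarilyLinear (n : ℕ) (R : ℕ → T → T → Prop) : Prop :=
  ∀ x y : T, x ≠ y → ∃ k < n, R k x y ∨ R k y x

/-- A frame is stratified if `x <_m y` and `z <_k y` imply `x <_m z` for `k < m < n`. -/
def Stratified (n : ℕ) (R : ℕ → T → T → Prop) : Prop :=
  ∀ ⦃k m : ℕ⦄, k < m → m < n → ∀ ⦃x y z : T⦄, R m x y → R k z y → R m x z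

/-- The relations `≡_k` (for `k ≤ n`): `≡_n` is identity and `≡_k` is the
equivalence relation generated by the union of `<_k` and `≡_{k+1}`.
Equivalence classes of `≡_k` are the `k`-planes. -/
def eqvRel (R : ℕ → T → T → Prop) (n : ℕ) (k : ℕ) : T → T → Prop :=
  if _ : k < n then
    Relation.EqvGen fun x y => R k x y ∨ eqvRel R n (k + 1) x y
  else Eq
termination_by n - k
decreasing_by omega

/-- Kripke satisfaction in the model `(T, R, V)`. -/
def Sat (R : ℕ → T → T → Prop) (V : ℕ → T → Prop) : T → Formula → Prop
  | w, Formula.var p => V p w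
  | _, Formula.top => True
  | w, Formula.neg a => ¬ Sat R V w a
  | w, Formula.and a b => Sat R V w a ∧ Sat R V w b
  | w, Formula.or a b => Sat R V w a ∨ Sat R V w b
  | w, Formula.imp a b => Sat R V w a → Sat R V w b
  | w, Formula.box m a => ∀ v : T, R m w v → Sat R V v a

end Frames

/-- A set of formulas is consistent with the logic `L` if no finite conjunction
of its elements has its negation provable in `L`. -/
def SetConsistent (L : Formula → Prop) (S : Set Formula) : Prop :=
  ∀ l : List Formula, (∀ φ ∈ l, φ ∈ S) → ¬ L (Formula.neg (bigConj l))

/-- A maximal `L`-consistent set of `L_{[<n]}`-formulas. -/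
def MCS (L : Formula → Prop) (n : ℕ) (S : Set Formula) : Prop :=
  (∀ φ ∈ S, Formula.InLang n φ) ∧ SetConsistent L S ∧
  ∀ S' : Set Formula, (∀ φ ∈ S', Formula.InLang n φ) → S ⊆ S' → S ≠ S' → ¬ SetConsistent L S'

/-- The canonical accessibility relation `x <_m y`. -/
def canonR (m : ℕ) (x y : Set Formula) : Prop :=
  (∀ ψ : Formula, Formula.box m ψ ∈ x → ψ ∈ y) ∧
  (∃ ψ : Formula, Formula.box m ψ ∈ y ∧ Formula.box m ψ ∉ x)

/-- A set of formulas is `k`-maximal if it contains `¬ψ ∧ ⋀_{k≤m<n}[m]ψ` for some `ψ`. -/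
def kMaximal (n k : ℕ) (S : Set Formula) : Prop :=
  ∃ ψ : Formula, Formula.and (Formula.neg ψ) (boxConj k n ψ) ∈ S

namespace RespectsBool

variable {v : Formula → Bool}

theorem neg_iff (hv : RespectsBool v) (a : Formula) : v (Formula.neg a) = true ↔ ¬ v a = true := by
  simp [hv.2.1]

theorem and_iff (hv : RespectsBool v) (a b : Formula) :
    v (Formula.and a b) = true ↔ v a = true ∧ v b = true := by
  simp [hv.2.2.1]

theorem imp_iff (hv : RespectsBool v) (a b : Formula) :
    v (Formula.imp a b) = true ↔ (v a = true → v b = true) := by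
  cases h : v a <;> simp [hv.2.2.2.2, h]

theorem bigConj_iff (hv : RespectsBool v) (l : List Formula) :
    v (bigConj l) = true ↔ ∀ φ ∈ l, v φ = true := by
  induction l with
  | nil => simpa [bigConj] using hv.1
  | cons a l ih =>
    have h := hv.and_iff a (bigConj l)
    rw [ih] at h
    simpa [bigConj] using h

theorem boxConj_iff (hv : RespectsBool v) (m n : ℕ) (φ : Formula) :
    v (boxConj m n φ) = true ↔ ∀ i, m ≤ i → i < n → v (Formula.box i φ) = true := by
  simp only [boxConj, hv.bigConj_iff, List.mem_map, List.mem_range'_1]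
  constructor
  · exact fun h i h₁ h₂ => h _ ⟨i, ⟨h₁, by omega⟩, rfl⟩
  · rintro h _ ⟨i, ⟨h₁, h₂⟩, rfl⟩
    exact h i h₁ (by omega)

end RespectsBool

theorem Formula.inLang_bigConj {n : ℕ} {l : List Formula} (hl : ∀ φ ∈ l, Formula.InLang n φ) :
    Formula.InLang n (bigConj l) := by
  induction l with
  | nil => trivial
  | cons a l ih =>
    exact ⟨hl a (by simp), ih fun φ hφ => hl φ (by simp [hφ])⟩

theorem Formula.inLang_boxConj {m j n : ℕ} (hj : j ≤ n) {φ : Formula}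
    (hφ : Formula.InLang n φ) : Formula.InLang n (boxConj m j φ) := by
  apply Formula.inLang_bigConj
  simp only [List.mem_map, List.mem_range'_1]
  rintro _ ⟨i, hi, rfl⟩
  exact ⟨by omega, hφ⟩

namespace JnLin

open Formula

variable {n : ℕ}

/-- The tautological consequences of a single theorem are theorems. -/
theorem of_taut {a b : Formula} (h : JnLin n a) (ha : InLang n a) (hb : InLang n b)
    (hab : ∀ v, RespectsBool v → v a = true → v b = true) : JnLin n b :=
  mp (taut (fun v hv => (hv.imp_iff a b).2 (hab v hv)) ⟨ha, hb⟩) h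

/-- The tautological consequences of two theorems are theorems. -/
theorem of_taut₂ {a b c : Formula} (h₁ : JnLin n a) (h₂ : JnLin n b)
    (ha : InLang n a) (hb : InLang n b) (hc : InLang n c)
    (habc : ∀ v, RespectsBool v → v a = true → v b = true → v c = true) : JnLin n c := by
  refine mp (of_taut (b := imp b c) h₁ ha ⟨hb, hc⟩ fun v hv h => ?_) h₂
  exact (hv.imp_iff b c).2 (habc v hv h)

theorem imp_trans {a b c : Formula} (h₁ : JnLin n (imp a b)) (h₂ : JnLin n (imp b c))
    (ha : InLang n a) (hb : InLang n b) (hc : InLang n c) : JnLin n (imp a c) := by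
  refine of_taut₂ h₁ h₂ ⟨ha, hb⟩ ⟨hb, hc⟩ ⟨ha, hc⟩ fun v hv => ?_
  simp only [hv.imp_iff]
  tauto

theorem box_mono {k : ℕ} (hk : k < n) {a b : Formula} (h : JnLin n (imp a b))
    (ha : InLang n a) (hb : InLang n b) : JnLin n (imp (box k a) (box k b)) :=
  mp (distr hk a b ha hb) (nec hk h)

theorem box_mono₂ {k : ℕ} (hk : k < n) {a b c : Formula} (h : JnLin n (imp a (imp b c)))
    (ha : InLang n a) (hb : InLang n b) (hc : InLang n c) :
    JnLin n (imp (box k a) (imp (box k b) (box k c))) :=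
  imp_trans (box_mono hk h ha ⟨hb, hc⟩) (distr hk b c hb hc)
    ⟨hk, ha⟩ ⟨hk, hb, hc⟩ ⟨⟨hk, hb⟩, hk, hc⟩

theorem box_and {k : ℕ} (hk : k < n) {a b : Formula} (ha : InLang n a) (hb : InLang n b) :
    JnLin n (imp (box k a) (imp (box k b) (box k (and a b)))) := by
  refine box_mono₂ hk (taut (fun v hv => ?_) ⟨ha, hb, ha, hb⟩) ha hb ⟨ha, hb⟩
  simp only [hv.imp_iff, hv.and_iff]
  tauto

theorem box_bigConj {k : ℕ} (hk : k < n) {l : List Formula} (hl : ∀ φ ∈ l, InLang n φ) :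
    JnLin n (imp (bigConj (l.map (box k))) (box k (bigConj l))) := by
  induction l with
  | nil =>
    refine of_taut (nec hk (taut (fun v hv => hv.1) trivial)) ⟨hk, trivial⟩
      ⟨trivial, hk, trivial⟩ fun v hv h => ?_
    exact (hv.imp_iff _ _).2 fun _ => h
  | cons a l ih =>
    have ha : InLang n a := hl a (by simp)
    have hl' : ∀ φ ∈ l, InLang n φ := fun φ hφ => hl φ (by simp [hφ])
    have hc := inLang_bigConj hl'
    have hm : InLang n (bigConj (l.map (box k))) := by
      apply inLang_bigConj
      simp only [List.mem_map]
      rintro _ ⟨φ, hφ, rfl⟩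
      exact ⟨hk, hl' φ hφ⟩
    refine of_taut₂ (c := imp (and (box k a) (bigConj (l.map (box k))))
      (box k (and a (bigConj l)))) (box_and hk ha hc) (ih hl')
      ⟨⟨hk, ha⟩, ⟨hk, hc⟩, hk, ha, hc⟩ ⟨hm, hk, hc⟩ ⟨⟨⟨hk, ha⟩, hm⟩, hk, ha, hc⟩ fun v hv => ?_
    simp only [hv.imp_iff, hv.and_iff]
    tauto

theorem boxConj_imp_box {k j : ℕ} (hj : j < n) {φ : Formula} (hφ : InLang n φ) :
    JnLin n (imp (boxConj k j φ) (box j (boxConj k j φ))) := by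
  suffices H : ∀ l : List Formula, (∀ χ ∈ l, ∃ i < j, χ = box i φ) →
      JnLin n (imp (bigConj l) (box j (bigConj l))) by
    apply H
    simp only [List.mem_map, List.mem_range'_1]
    rintro _ ⟨i, hi, rfl⟩
    exact ⟨i, by omega, rfl⟩
  intro l hl
  have hL : ∀ χ ∈ l, InLang n χ := by
    intro χ hχ
    obtain ⟨i, hi, rfl⟩ := hl χ hχ
    exact ⟨hi.trans hj, hφ⟩
  have hc := inLang_bigConj hL
  have hm : InLang n (bigConj (l.map (box j))) := by
    apply inLang_bigConj
    simp only [List.mem_map]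
    rintro _ ⟨χ, hχ, rfl⟩
    exact ⟨hj, hL χ hχ⟩
  refine imp_trans ?_ (box_bigConj hj hL) hc hm ⟨hj, hc⟩
  clear hc hm
  induction l with
  | nil => exact taut (fun v hv => (hv.imp_iff _ _).2 id) ⟨trivial, trivial⟩
  | cons a l ih =>
    have hL' : ∀ χ ∈ l, InLang n χ := fun χ hχ => hL χ (by simp [hχ])
    have hc := inLang_bigConj hL'
    have ha := hL a (by simp)
    have hm : InLang n (bigConj (l.map (box j))) := by
      apply inLang_bigConj
      simp only [List.mem_map]
      rintro _ ⟨χ, hχ, rfl⟩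
      exact ⟨hj, hL' χ hχ⟩
    have h₁ : JnLin n (imp a (box j a)) := by
      obtain ⟨i, hi, rfl⟩ := hl a (by simp)
      exact trans2 hi.le hj φ hφ
    refine of_taut₂ (c := imp (and a (bigConj l)) (and (box j a) (bigConj (l.map (box j)))))
      h₁ (ih (fun χ hχ => hl χ (by simp [hχ])) hL')
      ⟨ha, hj, ha⟩ ⟨hc, hm⟩ ⟨⟨ha, hc⟩, ⟨hj, ha⟩, hm⟩ fun v hv => ?_
    simp only [hv.imp_iff, hv.and_iff]
    tauto

theorem box_boxConj_imp_step {k j : ℕ} (hkj : k ≤ j) (hj : j < n) {ψ : Formula}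
    (hψ : InLang n ψ) :
    JnLin n (imp (box k (imp (boxConj k (j + 1) ψ) ψ)) (box k (imp (boxConj k j ψ) ψ))) := by
  have hk := hkj.trans_lt hj
  set A := boxConj k j ψ with hA
  set D := imp (boxConj k (j + 1) ψ) ψ with hD
  have iA : InLang n A := inLang_boxConj hj.le hψ
  have iD : InLang n D := ⟨inLang_boxConj hj hψ, hψ⟩
  have ijψ : InLang n (box j ψ) := ⟨hj, hψ⟩
  have hv_iff : ∀ v, RespectsBool v →
      (v D = true ↔ (v A = true → v (box j ψ) = true → v ψ = true)) := by
    intro v hv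
    rw [hD, hA, hv.imp_iff, hv.boxConj_iff, hv.boxConj_iff]
    constructor
    · intro h h₁ h₂
      refine h fun i hi hij => ?_
      rcases Nat.lt_succ_iff_lt_or_eq.1 hij with hlt | rfl
      exacts [h₁ i hi hlt, h₂]
    · exact fun h h₁ => h (fun i hi hij => h₁ i hi (by omega)) (h₁ j hkj (by omega))
  have h₁ : JnLin n (imp D (imp A (imp (box j ψ) ψ))) := by
    refine taut (fun v hv => ?_) ⟨iD, iA, ijψ, hψ⟩
    simp only [hv.imp_iff, hv_iff v hv]
    exact id
  have h₂ : JnLin n (imp (box j D) (imp A (box j (imp (box j ψ) ψ)))) := by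
    refine of_taut₂ (box_mono₂ hj h₁ iD iA ⟨ijψ, hψ⟩) (boxConj_imp_box hj hψ)
      ⟨⟨hj, iD⟩, ⟨hj, iA⟩, hj, ijψ, hψ⟩ ⟨iA, hj, iA⟩ ⟨⟨hj, iD⟩, iA, hj, ijψ, hψ⟩
      fun v hv => ?_
    simp only [hv.imp_iff]
    tauto
  have h₃ : JnLin n (imp (box j D) (imp D (imp A ψ))) := by
    refine of_taut₂ h₂ (lob hj ψ hψ) ⟨⟨hj, iD⟩, iA, hj, ijψ, hψ⟩ ⟨⟨hj, ijψ, hψ⟩, ijψ⟩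
      ⟨⟨hj, iD⟩, iD, iA, hψ⟩ fun v hv => ?_
    simp only [hv.imp_iff, hv_iff v hv]
    tauto
  refine of_taut₂ (box_mono₂ hk h₃ ⟨hj, iD⟩ iD ⟨iA, hψ⟩) (trans1 hkj hj D iD)
    ⟨⟨hk, hj, iD⟩, ⟨hk, iD⟩, hk, iA, hψ⟩ ⟨⟨hk, iD⟩, hk, hj, iD⟩ ⟨⟨hk, iD⟩, hk, iA, hψ⟩
    fun v hv => ?_
  simp only [hv.imp_iff]
  tauto

/-- A simultaneous form of Löb's axiom for the modalities `[m]` with `k ≤ m < n`. -/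
theorem box_boxConj_lob {k : ℕ} (hk : k < n) {ψ : Formula} (hψ : InLang n ψ) :
    JnLin n (imp (box k (imp (boxConj k n ψ) ψ)) (box k ψ)) := by
  have iC : ∀ j ≤ n, InLang n (box k (imp (boxConj k j ψ) ψ)) := fun j hj =>
    ⟨hk, inLang_boxConj hj hψ, hψ⟩
  have H : JnLin n (imp (box k (imp (boxConj k n ψ) ψ)) (box k (imp (boxConj k k ψ) ψ))) := by
    refine Nat.decreasingInduction'
      (P := fun j => JnLin n (imp (box k (imp (boxConj k n ψ) ψ)) (box k (imp (boxConj k j ψ) ψ))))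
      (fun j hj hkj ih => ?_) hk.le ?_
    · exact imp_trans ih (box_boxConj_imp_step hkj hj hψ) (iC n le_rfl) (iC _ hj) (iC j hj.le)
    · exact taut (fun v hv => (hv.imp_iff _ _).2 id) ⟨iC n le_rfl, iC n le_rfl⟩
  refine imp_trans H (box_mono hk ?_ (iC k hk.le).2 hψ) (iC n le_rfl) (iC k hk.le) ⟨hk, hψ⟩
  refine taut (fun v hv => ?_) ⟨(iC k hk.le).2, hψ⟩
  simp only [hv.imp_iff, hv.boxConj_iff]
  exact fun h => h fun i h₁ h₂ => by omega

end JnLin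

/-- Lindenbaum's lemma. -/
theorem SetConsistent.exists_mcs {L : Formula → Prop} {n : ℕ} {S : Set Formula}
    (hS : SetConsistent L S) (hL : ∀ φ ∈ S, Formula.InLang n φ) :
    ∃ y, S ⊆ y ∧ MCS L n y := by
  obtain ⟨y, hSy, hy⟩ := zorn_subset_nonempty
    {T : Set Formula | (∀ φ ∈ T, Formula.InLang n φ) ∧ SetConsistent L T} (by
      intro c hc hchain hne
      refine ⟨⋃₀ c, ⟨?_, ?_⟩, fun s hs => Set.subset_sUnion_of_mem hs⟩
      · rintro φ ⟨T, hT, hφ⟩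
        exact (hc hT).1 φ hφ
      · intro l hl
        obtain ⟨T, hT, hlT⟩ := DirectedOn.exists_mem_subset_of_finite_of_subset_sUnion
          hne hchain.directedOn (List.finite_toSet l) hl
        exact (hc hT).2 l hlT) S ⟨hL, hS⟩
  refine ⟨y, hSy, hy.prop.1, hy.prop.2, fun S' hS' hsub hne hcon => hne ?_⟩
  exact hsub.antisymm (hy.le_of_ge ⟨hS', hcon⟩ hsub)

/-- If `x` is consistent and `¬[k]ψ ∈ x`, then `¬ψ ∧ ⋀_{k≤m<n}[m]ψ` and `[k]ψ` are jointly
consistent with the formulas necessary at `x`. -/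
theorem SetConsistent.successor {n k : ℕ} (hk : k < n) {x : Set Formula}
    (hx : SetConsistent (JnLin n) x) (hL : ∀ φ ∈ x, Formula.InLang n φ)
    {ψ : Formula} (h : Formula.neg (Formula.box k ψ) ∈ x) :
    SetConsistent (JnLin n) ({φ | Formula.box k φ ∈ x} ∪
      {Formula.and (Formula.neg ψ) (boxConj k n ψ), Formula.box k ψ}) := by
  classical
  intro l hl hprov
  have hψ : Formula.InLang n ψ := (hL _ h).2
  have iC : Formula.InLang n (boxConj k n ψ) := Formula.inLang_boxConj le_rfl hψ
  have hlL : ∀ φ ∈ l, Formula.InLang n φ := by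
    intro φ hφ
    rcases hl φ hφ with hx' | rfl | rfl
    exacts [(hL _ hx').2, ⟨hψ, iC⟩, ⟨hk, hψ⟩]
  set l' := l.filter fun φ => Formula.box k φ ∈ x
  have hl'L : ∀ φ ∈ l', Formula.InLang n φ := fun φ hφ => hlL φ (List.mem_of_mem_filter hφ)
  have hl'x : ∀ φ ∈ l'.map (Formula.box k), φ ∈ x := by
    simp only [List.mem_map]
    rintro _ ⟨φ, hφ, rfl⟩
    simpa using (List.mem_filter.1 hφ).2
  have iD : Formula.InLang n (Formula.imp (boxConj k n ψ) ψ) := ⟨iC, hψ⟩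
  have il' := Formula.inLang_bigConj hl'L
  have im := Formula.inLang_bigConj fun φ hφ => hL φ (hl'x φ hφ)
  have h₁ : JnLin n (Formula.imp (bigConj l') (Formula.imp (boxConj k n ψ) ψ)) := by
    refine JnLin.of_taut hprov (Formula.inLang_bigConj hlL) ⟨il', iD⟩ fun v hv hn => ?_
    rw [hv.neg_iff, hv.bigConj_iff] at hn
    simp only [hv.imp_iff, hv.bigConj_iff l']
    intro h₂ h₃
    by_contra h₄
    refine hn fun φ hφ => ?_
    rcases hl φ hφ with hx' | rfl | rfl
    · exact h₂ φ (List.mem_filter.2 ⟨hφ, by simpa using hx'⟩)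
    · exact (hv.and_iff _ _).2 ⟨(hv.neg_iff _).2 h₄, h₃⟩
    · exact (hv.boxConj_iff k n ψ).1 h₃ k le_rfl hk
  have h₂ : JnLin n (Formula.imp (bigConj (l'.map (Formula.box k))) (Formula.box k ψ)) :=
    JnLin.imp_trans (JnLin.imp_trans (JnLin.box_bigConj hk hl'L) (JnLin.box_mono hk h₁ il' iD)
      im ⟨hk, il'⟩ ⟨hk, iD⟩) (JnLin.box_boxConj_lob hk hψ) im ⟨hk, iD⟩ ⟨hk, hψ⟩
  refine hx (Formula.neg (Formula.box k ψ) :: l'.map (Formula.box k)) ?_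
    (JnLin.of_taut h₂ ⟨im, hk, hψ⟩ (Formula.inLang_bigConj (l := _ :: _) ?_) fun v hv => ?_)
  · simpa only [List.forall_mem_cons] using ⟨h, hl'x⟩
  · simpa only [List.forall_mem_cons] using ⟨hL _ h, fun φ hφ => hL φ (hl'x φ hφ)⟩
  · rw [hv.imp_iff, hv.neg_iff, hv.bigConj_iff, hv.bigConj_iff, List.forall_mem_cons, hv.neg_iff]
    tauto

/-- If `x` is a maximal `J_n.lin`-consistent set, `k < n`, and `¬[k]ψ ∈ x`,
then there is a maximal consistent `y` with `x <_k y` and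
`¬ψ ∧ ⋀_{k≤m<n}[m]ψ ∈ y`; in particular `y` is `k`-maximal, witnessed by `ψ`. -/
theorem exists_k_maximal_successor (n k : ℕ) (hk : k < n)
    (x : Set Formula) (hx : MCS (JnLin n) n x)
    (ψ : Formula) (h : Formula.neg (Formula.box k ψ) ∈ x) :
    ∃ y : Set Formula, MCS (JnLin n) n y ∧ canonR k x y ∧
      Formula.and (Formula.neg ψ) (boxConj k n ψ) ∈ y := by
  have hψ : Formula.InLang n ψ := (hx.1 _ h).2
  obtain ⟨y, hSy, hy⟩ := (hx.2.1.successor hk hx.1 h).exists_mcs (n := n) (by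
    rintro φ (hφ | rfl | rfl)
    exacts [(hx.1 _ hφ).2, ⟨hψ, Formula.inLang_boxConj le_rfl hψ⟩, ⟨hk, hψ⟩])
  refine ⟨y, hy, ⟨fun φ hφ => hSy (Or.inl hφ), ψ, hSy (by simp), fun hbox => ?_⟩, hSy (by simp)⟩
  refine hx.2.1 [Formula.neg (Formula.box k ψ), Formula.box k ψ] (by simp [h, hbox])
    (JnLin.taut (fun v hv => ?_) ⟨⟨hk, hψ⟩, ⟨hk, hψ⟩, trivial⟩)
  rw [hv.neg_iff, hv.bigConj_iff]
  simp [hv.neg_iff]
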